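/- Let N : (ℤ^d×ℤ^d) × (ℤ^d×ℤ^d) → ℂ be a family of complex numbers such that for every n ∈ ℕ, sup_{α̃,β̃} ⟨(α̃,β̃)⟩^n · |N_{α̃,β̃}| < ∞. Then each G_{α̃,β̃} is a Schwartz function on ℝ^{2d}, for every Schwartz seminorm p on 𝒮(ℝ^{2d};ℂ) the sum Σ_{α̃,β̃} p(N_{α̃,β̃} · G_{α̃,β̃}) is finite, and consequently the family (N_{α̃,β̃} · G_{α̃,β̃})_{α̃,β̃} is summable in the Schwartz space 𝒮(ℝ^{2d};ℂ). -/

import Mathlib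

open MeasureTheory Filter
open scoped ENNReal

noncomputable section

/-- Japanese bracket `⟨v⟩ = √(1+‖v‖²)` with the Euclidean norm on `ℝ^N`. -/
def jbV {N : ℕ} (v : Fin N → ℝ) : ℝ := Real.sqrt (1 + ∑ i, v i ^ 2)

/-- A tempered weight on `ℝ^N`: a positive function `m` with
`m(u+v) ≤ C·m(u)·⟨v⟩^a` for some `C, a > 0`. -/
def IsTemperedWeight {N : ℕ} (m : (Fin N → ℝ) → ℝ) : Prop :=
  (∀ u, 0 < m u) ∧ ∃ C > 0, ∃ a : ℝ, 0 < a ∧ ∀ u v, m (u + v) ≤ C * m u * jbV v ^ a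

/-- A regular magnetic field on `ℝ^d`: smooth, antisymmetric, closed, with all
derivatives of all components bounded. -/
structure IsRegularMagneticField (d : ℕ) (B : Fin d → Fin d → (Fin d → ℝ) → ℝ) : Prop where
  smooth : ∀ j k, ContDiff ℝ (⊤ : ℕ∞) (B j k)
  antisymm : ∀ j k x, B j k x = - B k j x
  closed : ∀ i j k, ∀ x : Fin d → ℝ,
      fderiv ℝ (B j k) x (Pi.single i 1) + fderiv ℝ (B k i) x (Pi.single j 1)
        + fderiv ℝ (B i j) x (Pi.single k 1) = 0
  derivBounded : ∀ j k, ∀ n : ℕ, ∃ C : ℝ, ∀ x, ‖iteratedFDeriv ℝ n (B j k) x‖ ≤ C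

/-- The transversal-gauge vector potential based at `y`:
`A_k(x;y) = Σ_j ∫₀¹ s·(x_j−y_j)·B_{jk}(y+s(x−y)) ds`. -/
def magA (d : ℕ) (B : Fin d → Fin d → (Fin d → ℝ) → ℝ) (y x : Fin d → ℝ) (k : Fin d) : ℝ :=
  ∑ j, ∫ s in (0:ℝ)..1, s * (x j - y j) * B j k (y + s • (x - y))

/-- The circulation `φ(x,y) = Σ_k ∫₀¹ A_k(y+s(x−y))·(x_k−y_k) ds` of `A = A(·;0)`
along the segment from `y` to `x`. -/
def magPhi (d : ℕ) (B : Fin d → Fin d → (Fin d → ℝ) → ℝ) (x y : Fin d → ℝ) : ℝ :=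
  ∑ k, ∫ s in (0:ℝ)..1, magA d B 0 (y + s • (x - y)) k * (x k - y k)

/-- A window function for the magnetic Gabor frame: smooth, compactly supported in
`(−1,1)^d`, with `Σ_{α∈ℤ^d} 𝔤(x−α)² = 1`. -/
structure IsWindow (d : ℕ) (g : (Fin d → ℝ) → ℝ) : Prop where
  smooth : ContDiff ℝ (⊤ : ℕ∞) g
  compactSupport : HasCompactSupport g
  support_subset : ∀ x : Fin d → ℝ, g x ≠ 0 → ∀ i, |x i| < 1
  partition : ∀ x : Fin d → ℝ, ∑' α : Fin d → ℤ, (g (x - fun i => (α i : ℝ))) ^ 2 = 1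

abbrev Idx (d : ℕ) := (Fin d → ℤ) × (Fin d → ℤ)
abbrev Idx2 (d : ℕ) := Idx d × Idx d
abbrev E1 (d : ℕ) := Fin d → ℝ
abbrev E2 (d : ℕ) := E1 d × E1 d
abbrev E4 (d : ℕ) := E2 d × E2 d

/-- The magnetic Gabor function
`𝒢_α̃(x) = (2π)^{−d/2}·e^{iφ(x,α)}·𝔤(x−α)·e^{iα'·(x−α)}` for `α̃ = (α,α')`. -/
def gabor (d : ℕ) (B : Fin d → Fin d → E1 d → ℝ) (g : E1 d → ℝ) (a : Idx d) (x : E1 d) : ℂ :=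
  (((2 * Real.pi) ^ (-(d : ℝ) / 2) : ℝ) : ℂ) *
    Complex.exp (Complex.I * (magPhi d B x (fun i => (a.1 i : ℝ)) : ℂ)) *
    ((g (x - fun i => (a.1 i : ℝ)) : ℝ) : ℂ) *
    Complex.exp (Complex.I * ((∑ i, (a.2 i : ℝ) * (x i - (a.1 i : ℝ)) : ℝ) : ℂ))

/-- `G_{α̃,β̃}(x,y) = 𝒢_α̃(x)·conj(𝒢_β̃(y))`. -/
def gaborTensor (d : ℕ) (B : Fin d → Fin d → E1 d → ℝ) (g : E1 d → ℝ) (a b : Idx d)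
    (p : E2 d) : ℂ :=
  gabor d B g a p.1 * (starRingEnd ℂ) (gabor d B g b p.2)

/-- `T_{α̃,β̃}(x,y) = conj(𝒢_α̃(x))·𝒢_β̃(y)`. -/
def gaborDual (d : ℕ) (B : Fin d → Fin d → E1 d → ℝ) (g : E1 d → ℝ) (a b : Idx d)
    (p : E2 d) : ℂ :=
  (starRingEnd ℂ) (gabor d B g a p.1) * gabor d B g b p.2

/-- The frame coefficient `c_{α̃,β̃}(F) = ∫ F(x,y)·conj(𝒢_α̃(x))·𝒢_β̃(y) dx dy`. -/
def frameCoef (d : ℕ) (B : Fin d → Fin d → E1 d → ℝ) (g : E1 d → ℝ) (a b : Idx d)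
    (F : E2 d → ℂ) : ℂ :=
  ∫ p : E2 d, F p * (starRingEnd ℂ) (gabor d B g a p.1) * gabor d B g b p.2

/-- `⟨(α̃,β̃)⟩` with `(α̃,β̃)` regarded as a point of `ℝ^{4d}`. -/
def jbIdxPair (d : ℕ) (a b : Idx d) : ℝ :=
  Real.sqrt (1 + (∑ i, ((a.1 i : ℝ)) ^ 2) + (∑ i, ((a.2 i : ℝ)) ^ 2)
    + (∑ i, ((b.1 i : ℝ)) ^ 2) + ∑ i, ((b.2 i : ℝ)) ^ 2)

/-- Euclidean Japanese bracket on `ℝ^{4d} = E4 d`. -/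
def jbE4 (d : ℕ) (v : E4 d) : ℝ :=
  Real.sqrt (1 + (∑ i, v.1.1 i ^ 2) + (∑ i, v.1.2 i ^ 2) + (∑ i, v.2.1 i ^ 2) + ∑ i, v.2.2 i ^ 2)

/-- A tempered weight on `ℝ^{4d}`. -/
def IsTemperedWeightE4 (d : ℕ) (M : E4 d → ℝ) : Prop :=
  (∀ u, 0 < M u) ∧ ∃ C > 0, ∃ a : ℝ, 0 < a ∧ ∀ u v, M (u + v) ≤ C * M u * jbE4 d v ^ a

/-- Euclidean Japanese bracket on `ℝ^N × ℝ^N`. -/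
def jbP {N : ℕ} (v : (Fin N → ℝ) × (Fin N → ℝ)) : ℝ :=
  Real.sqrt (1 + (∑ i, v.1 i ^ 2) + ∑ i, v.2 i ^ 2)

/-- A tempered weight on `ℝ^N × ℝ^N ≅ ℝ^{2N}`. -/
def IsTemperedWeightProd {N : ℕ} (m : (Fin N → ℝ) × (Fin N → ℝ) → ℝ) : Prop :=
  (∀ u, 0 < m u) ∧ ∃ C > 0, ∃ a : ℝ, 0 < a ∧ ∀ u v, m (u + v) ≤ C * m u * jbP v ^ a

/-- `⟨(α̃,β̃) − (γ̃,δ̃)⟩` for pairs of indices in `ℤ^{2d} × ℤ^{2d}`. -/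
def jbDiffIdx2 (d : ℕ) (p q : Idx2 d) : ℝ :=
  Real.sqrt (1 + (∑ i, ((p.1.1 i - q.1.1 i : ℤ) : ℝ) ^ 2) + (∑ i, ((p.1.2 i - q.1.2 i : ℤ) : ℝ) ^ 2)
    + (∑ i, ((p.2.1 i - q.2.1 i : ℤ) : ℝ) ^ 2) + ∑ i, ((p.2.2 i - q.2.2 i : ℤ) : ℝ) ^ 2)

/-- The midpoint `((α̃,β̃)+(γ̃,δ̃))/2 ∈ ℝ^{4d}`. -/
def midIdx2 (d : ℕ) (p q : Idx2 d) : E4 d :=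
  ((fun i => ((p.1.1 i + q.1.1 i : ℤ) : ℝ) / 2, fun i => ((p.1.2 i + q.1.2 i : ℤ) : ℝ) / 2),
   (fun i => ((p.2.1 i + q.2.1 i : ℤ) : ℝ) / 2, fun i => ((p.2.2 i + q.2.2 i : ℤ) : ℝ) / 2))

/-- Membership in the Hörmander class `S₀(M)` on `ℝ^{4d}`: smooth, with all
derivatives dominated by `M`. -/
def InS0 (d : ℕ) (M : E4 d → ℝ) (Φ : E4 d → ℂ) : Prop :=
  ContDiff ℝ (⊤ : ℕ∞) Φ ∧ ∀ n : ℕ, ∃ C : ℝ, ∀ X, ‖iteratedFDeriv ℝ n Φ X‖ ≤ C * M X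

/-- The seminorms `‖Φ‖_{S₀(M),k}`. -/
def s0Seminorm (d : ℕ) (M : E4 d → ℝ) (k : ℕ) (Φ : E4 d → ℂ) : ℝ :=
  ∑ n ∈ Finset.range (k + 1), ⨆ X : E4 d, ‖iteratedFDeriv ℝ n Φ X‖ / M X

/-- The integrand of the inner (oscillatory) integral defining `H_{(α̃,β̃),(γ̃,δ̃)}`,
evaluated at `X = ((v_L,ξ_L),(v_R,ξ_R))` and `z = (z_L,z_R)`. -/
def gaborKernel4 (d : ℕ) (B : Fin d → Fin d → E1 d → ℝ) (g : E1 d → ℝ) (ab gd : Idx2 d)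
    (X : E4 d) (z : E2 d) : ℂ :=
  Complex.exp (Complex.I * (((∑ i, X.1.2 i * z.1 i) - ∑ i, X.2.2 i * z.2 i : ℝ) : ℂ)) *
  Complex.exp (Complex.I * ((magPhi d B (X.1.1 + (2 : ℝ)⁻¹ • z.1) (X.1.1 - (2 : ℝ)⁻¹ • z.1)
      - magPhi d B (X.2.1 + (2 : ℝ)⁻¹ • z.2) (X.2.1 - (2 : ℝ)⁻¹ • z.2) : ℝ) : ℂ)) *
  gabor d B g gd.1 (X.1.1 + (2 : ℝ)⁻¹ • z.1) *
  (starRingEnd ℂ) (gabor d B g gd.2 (X.2.1 + (2 : ℝ)⁻¹ • z.2)) *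
  (starRingEnd ℂ) (gabor d B g ab.1 (X.1.1 - (2 : ℝ)⁻¹ • z.1)) *
  gabor d B g ab.2 (X.2.1 - (2 : ℝ)⁻¹ • z.2)

/-- The kernel `H_{(α̃,β̃),(γ̃,δ̃)}` on `ℝ^{4d}`. -/
def matH (d : ℕ) (B : Fin d → Fin d → E1 d → ℝ) (g : E1 d → ℝ) (ab gd : Idx2 d)
    (X : E4 d) : ℂ :=
  (((2 * Real.pi) ^ (-(2 * (d : ℝ))) : ℝ) : ℂ) * ∫ z : E2 d, gaborKernel4 d B g ab gd X z

/-- The matrix element `𝕄_{(α̃,β̃),(γ̃,δ̃)}[Φ] = ∫ Φ·H_{(α̃,β̃),(γ̃,δ̃)}`. -/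
def matElem (d : ℕ) (B : Fin d → Fin d → E1 d → ℝ) (g : E1 d → ℝ) (Φ : E4 d → ℂ)
    (ab gd : Idx2 d) : ℂ :=
  ∫ X : E4 d, Φ X * matH d B g ab gd X

/-- The dequantized frame symbol
`g_{α̃,γ̃}(v,ξ) = ∫ e^{−iξ·z}·e^{−iφ(v+z/2,v−z/2)}·𝒢_α̃(v+z/2)·conj(𝒢_γ̃(v−z/2)) dz`. -/
def deqSymbol (d : ℕ) (B : Fin d → Fin d → E1 d → ℝ) (g : E1 d → ℝ) (ac : Idx d × Idx d)
    (vξ : E2 d) : ℂ :=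
  ∫ z : E1 d,
    Complex.exp (-Complex.I * ((∑ i, vξ.2 i * z i : ℝ) : ℂ)) *
    Complex.exp (-Complex.I * ((magPhi d B (vξ.1 + (2 : ℝ)⁻¹ • z) (vξ.1 - (2 : ℝ)⁻¹ • z) : ℝ) : ℂ)) *
    gabor d B g ac.1 (vξ.1 + (2 : ℝ)⁻¹ • z) *
    (starRingEnd ℂ) (gabor d B g ac.2 (vξ.1 - (2 : ℝ)⁻¹ • z))

/-! ### Functions of temperate growth -/

namespace Function.HasTemperateGrowth

universe u

variable {E F : Type*} [NormedAddCommGroup E] [NormedSpace ℝ E]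
  [NormedAddCommGroup F] [NormedSpace ℝ F]

/-- Integrating a function of temperate growth over a bounded interval in its first variable
gives a function which is differentiable, with derivative obtained under the integral sign. -/
lemma hasFDerivAt_intervalIntegral {f : ℝ × E → F} (hf : f.HasTemperateGrowth) (a b : ℝ) (x₀ : E) :
    HasFDerivAt (fun x => ∫ s in a..b, f (s, x))
      (∫ s in a..b, (fderiv ℝ f (s, x₀)).comp (ContinuousLinearMap.inr ℝ ℝ E)) x₀ := by
  have hd : Differentiable ℝ f := hf.1.differentiable (by simp)
  have hc : Continuous (fderiv ℝ f) := hf.1.continuous_fderiv (by simp)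
  obtain ⟨k, C, hC, h⟩ := hf.norm_iteratedFDeriv_le_uniform 1
  have hder : ∀ p, ‖fderiv ℝ f p‖ ≤ C * (1 + ‖p‖) ^ k := fun p => by
    simpa [← norm_iteratedFDeriv_one] using h 1 le_rfl p
  have hslice (x : E) : Continuous fun s : ℝ => f (s, x) :=
    hf.1.continuous.comp (by fun_prop)
  have hslice' : Continuous fun s : ℝ =>
      (fderiv ℝ f (s, x₀)).comp (ContinuousLinearMap.inr ℝ ℝ E) :=
    (hc.comp (by fun_prop : Continuous fun s : ℝ => (s, x₀))).clm_comp continuous_const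
  refine intervalIntegral.hasFDerivAt_integral_of_dominated_of_fderiv_le
    (F := fun x s => f (s, x))
    (F' := fun x s => (fderiv ℝ f (s, x)).comp (ContinuousLinearMap.inr ℝ ℝ E))
    (bound := fun s => C * (1 + (|s| + (‖x₀‖ + 1))) ^ k)
    (Metric.ball_mem_nhds x₀ one_pos) ?_ ?_ ?_ ?_ ?_ ?_
  · exact Eventually.of_forall fun x => (hslice x).aestronglyMeasurable
  · exact (hslice x₀).intervalIntegrable _ _
  · exact hslice'.aestronglyMeasurable
  · refine Eventually.of_forall fun s _ x hx => ?_
    have hx' : ‖x‖ ≤ ‖x₀‖ + 1 := by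
      have := norm_le_norm_add_norm_sub' x x₀
      have h1 : ‖x - x₀‖ < 1 := by simpa [dist_eq_norm] using hx
      linarith
    have hp : ‖((s, x) : ℝ × E)‖ ≤ |s| + (‖x₀‖ + 1) := by
      rw [Prod.norm_def, Real.norm_eq_abs]
      exact max_le (by linarith [norm_nonneg x₀]) (by linarith [abs_nonneg s])
    calc _ ≤ ‖fderiv ℝ f (s, x)‖ * ‖ContinuousLinearMap.inr ℝ ℝ E‖ :=
          ContinuousLinearMap.opNorm_comp_le _ _
      _ ≤ ‖fderiv ℝ f (s, x)‖ * 1 := by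
          gcongr
          exact ContinuousLinearMap.norm_inr_le_one ℝ ℝ E
      _ ≤ C * (1 + (|s| + (‖x₀‖ + 1))) ^ k := by
          rw [mul_one]
          refine (hder _).trans ?_
          gcongr
  · exact Continuous.intervalIntegrable (by fun_prop) _ _
  · refine Eventually.of_forall fun s _ x _ => ?_
    exact (hd (s, x)).hasFDerivAt.comp x (hasFDerivAt_prodMk_right s x)

lemma norm_intervalIntegral_le {f : ℝ × E → F} (hf : f.HasTemperateGrowth) (a b : ℝ) :
    ∃ (k : ℕ) (C : ℝ), ∀ x, ‖∫ s in a..b, f (s, x)‖ ≤ C * (1 + ‖x‖) ^ k := by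
  obtain ⟨k, C, hC, h⟩ := hf.norm_iteratedFDeriv_le_uniform 0
  refine ⟨k, C * (1 + |a| + |b|) ^ k * |b - a|, fun x => ?_⟩
  have key : ∀ s ∈ Set.uIoc a b,
      ‖f (s, x)‖ ≤ C * (1 + |a| + |b|) ^ k * (1 + ‖x‖) ^ k := by
    intro s hs
    have hs' : |s| ≤ |a| + |b| := by
      rw [Set.mem_uIoc] at hs
      rw [abs_le]
      have := neg_abs_le a; have := le_abs_self a; have := neg_abs_le b; have := le_abs_self b
      have := abs_nonneg a; have := abs_nonneg b
      rcases hs with hs | hs <;> constructor <;> linarith [hs.1, hs.2]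
    have hp : 1 + ‖((s, x) : ℝ × E)‖ ≤ (1 + |a| + |b|) * (1 + ‖x‖) := by
      have h0 : ‖((s, x) : ℝ × E)‖ ≤ |s| + ‖x‖ := by
        rw [Prod.norm_def, Real.norm_eq_abs]
        exact max_le (by linarith [norm_nonneg x]) (by linarith [abs_nonneg s])
      nlinarith [mul_nonneg (add_nonneg (abs_nonneg a) (abs_nonneg b)) (norm_nonneg x)]
    have := h 0 le_rfl (s, x)
    rw [norm_iteratedFDeriv_zero] at this
    refine this.trans ?_
    rw [mul_assoc, ← mul_pow]
    gcongr
  refine (intervalIntegral.norm_integral_le_of_norm_le_const key).trans (le_of_eq ?_)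
  ring

lemma contDiff_and_bound_intervalIntegral {E : Type u} [NormedAddCommGroup E]
    [NormedSpace ℝ E] (a b : ℝ) (n : ℕ) :
    ∀ {F : Type u} [NormedAddCommGroup F] [NormedSpace ℝ F] {f : ℝ × E → F},
      f.HasTemperateGrowth → ContDiff ℝ n (fun x => ∫ s in a..b, f (s, x)) ∧
      ∃ (k : ℕ) (C : ℝ), ∀ x,
        ‖iteratedFDeriv ℝ n (fun x => ∫ s in a..b, f (s, x)) x‖ ≤ C * (1 + ‖x‖) ^ k := by
  induction n with
  | zero =>
    intro F _ _ f hf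
    refine ⟨contDiff_zero.2 ?_, ?_⟩
    · exact continuous_iff_continuousAt.2 fun x =>
        (hf.hasFDerivAt_intervalIntegral a b x).continuousAt
    · simpa only [norm_iteratedFDeriv_zero] using hf.norm_intervalIntegral_le a b
  | succ n ih =>
    intro F _ _ f hf
    have hf' : (fun p : ℝ × E =>
        (fderiv ℝ f p).comp (ContinuousLinearMap.inr ℝ ℝ E)).HasTemperateGrowth := by
      have h1 : (fderiv ℝ f).HasTemperateGrowth := by
        refine ⟨hf.1.fderiv_right (by simp), fun m => ?_⟩
        obtain ⟨k, C, h⟩ := hf.2 (m + 1)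
        exact ⟨k, C, fun x => by simpa only [norm_iteratedFDeriv_fderiv] using h x⟩
      exact ((ContinuousLinearMap.compL ℝ E (ℝ × E) F).flip
        (ContinuousLinearMap.inr ℝ ℝ E)).hasTemperateGrowth.comp h1
    have hfd : fderiv ℝ (fun x => ∫ s in a..b, f (s, x)) =
        fun x => ∫ s in a..b, (fderiv ℝ f (s, x)).comp (ContinuousLinearMap.inr ℝ ℝ E) :=
      funext fun x => (hf.hasFDerivAt_intervalIntegral a b x).fderiv
    obtain ⟨h1, k, C, h2⟩ := ih hf'
    refine ⟨?_, k, C, fun x => ?_⟩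
    · push_cast
      refine contDiff_succ_iff_fderiv.2
        ⟨fun x => (hf.hasFDerivAt_intervalIntegral a b x).differentiableAt, by simp, ?_⟩
      rw [hfd]
      exact h1
    · rw [← norm_iteratedFDeriv_fderiv, hfd]
      exact h2 x

/-- Integrating a function of temperate growth over a bounded interval in its first variable
gives a function of temperate growth. -/
lemma intervalIntegral {E F : Type u} [NormedAddCommGroup E] [NormedSpace ℝ E]
    [NormedAddCommGroup F] [NormedSpace ℝ F] {f : ℝ × E → F} (hf : f.HasTemperateGrowth)
    (a b : ℝ) : (fun x => ∫ s in a..b, f (s, x)).HasTemperateGrowth :=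
  ⟨contDiff_infty.2 fun n => (contDiff_and_bound_intervalIntegral a b n hf).1,
    fun n => (contDiff_and_bound_intervalIntegral a b n hf).2⟩

/-- A function of temperate growth in two variables has derivatives in the first variable that
are polynomially bounded in both variables. -/
lemma norm_iteratedFDeriv_prodMk_le {E' : Type*} [NormedAddCommGroup E'] [NormedSpace ℝ E']
    {f : E × E' → F} (hf : f.HasTemperateGrowth) (n : ℕ) :
    ∃ (k : ℕ) (C : ℝ), 0 ≤ C ∧ ∀ x y,
      ‖iteratedFDeriv ℝ n (fun x => f (x, y)) x‖ ≤ C * (1 + ‖(x, y)‖) ^ k := by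
  obtain ⟨k, C, hC, h⟩ := hf.norm_iteratedFDeriv_le_uniform n
  refine ⟨k, C, hC, fun x y => ?_⟩
  have hcomp : (fun x => f (x, y)) =
      (fun z => f (z + (0, y))) ∘ ContinuousLinearMap.inl ℝ E E' := by
    ext x; simp
  have hsm : ContDiff ℝ (⊤ : ℕ∞) fun z => f (z + (0, y)) := hf.1.comp (by fun_prop)
  rw [hcomp, ContinuousLinearMap.iteratedFDeriv_comp_right _ hsm x (mod_cast le_top),
    iteratedFDeriv_comp_add_right]
  refine (ContinuousMultilinearMap.norm_compContinuousLinearMap_le _ _).trans ?_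
  have hone : ∏ _i : Fin n, ‖ContinuousLinearMap.inl ℝ E E'‖ ≤ 1 :=
    Finset.prod_le_one (fun _ _ => norm_nonneg _)
      fun _ _ => ContinuousLinearMap.norm_inl_le_one ℝ E E'
  refine (mul_le_of_le_one_right (norm_nonneg _) hone).trans ?_
  simpa using h n le_rfl (x, y)

/-- The function `t ↦ exp (i t)` has temperate growth. -/
lemma cexp_I_mul_ofReal :
    (fun t : ℝ => Complex.exp (Complex.I * (t : ℂ))).HasTemperateGrowth := by
  have hder (n : ℕ) : iteratedDeriv n (fun t : ℝ => Complex.exp (Complex.I * (t : ℂ))) =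
      fun t : ℝ => Complex.I ^ n * Complex.exp (Complex.I * (t : ℂ)) := by
    induction n with
    | zero => simp
    | succ n ih =>
      rw [iteratedDeriv_succ, ih]
      ext t
      have h1 : HasDerivAt (fun t : ℝ => Complex.I * (t : ℂ)) (Complex.I * 1) t :=
        Complex.ofRealCLM.hasDerivAt.const_mul Complex.I
      rw [(h1.cexp.const_mul (Complex.I ^ n)).deriv]
      ring
  refine ⟨Complex.contDiff_exp.comp (contDiff_const.mul Complex.ofRealCLM.contDiff), fun n =>
    ⟨0, 1, fun t => ?_⟩⟩
  rw [norm_iteratedFDeriv_eq_norm_iteratedDeriv, hder]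
  simp [mul_comm Complex.I, Complex.norm_exp_ofReal_mul_I]

end Function.HasTemperateGrowth

/-! ### Summability in the Schwartz space -/

/-- A family of Schwartz functions which is absolutely summable for every Schwartz seminorm is
summable in the Schwartz space. -/
lemma SchwartzMap.summable_of_summable_seminorm {ι E F : Type*} [NormedAddCommGroup E]
    [NormedSpace ℝ E] [NormedAddCommGroup F] [NormedSpace ℝ F] [CompleteSpace F]
    {f : ι → SchwartzMap E F}
    (hf : ∀ k n : ℕ, Summable fun i => SchwartzMap.seminorm ℝ k n (f i)) : Summable f := by
  have hbd (n : ℕ) (i : ι) (x : E) :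
      ‖iteratedFDeriv ℝ n (f i) x‖ ≤ SchwartzMap.seminorm ℝ 0 n (f i) :=
    SchwartzMap.norm_iteratedFDeriv_le_seminorm ℝ (f i) n x
  have hder (n : ℕ) (x : E) : iteratedFDeriv ℝ n (fun y => ∑' i, f i y) x =
      ∑' i, iteratedFDeriv ℝ n (f i) x :=
    iteratedFDeriv_tsum_apply (N := ⊤) (fun i => (f i).smooth ⊤) (fun n _ => hf 0 n)
      (fun n i x _ => hbd n i x) le_top x
  have htail (k n : ℕ) (s : Finset ι) (x : E) :
      ‖x‖ ^ k * ‖∑' i, iteratedFDeriv ℝ n (f i) x - ∑ i ∈ s, iteratedFDeriv ℝ n (f i) x‖ ≤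
        ∑' i, SchwartzMap.seminorm ℝ k n (f i) - ∑ i ∈ s, SchwartzMap.seminorm ℝ k n (f i) := by
    have hs : Summable fun i => iteratedFDeriv ℝ n (f i) x :=
      .of_norm_bounded (hf 0 n) fun i => hbd n i x
    rw [← hs.sum_add_tsum_subtype_compl s, ← (hf k n).sum_add_tsum_subtype_compl s,
      add_sub_cancel_left, add_sub_cancel_left, ← norm_norm x, ← norm_pow, ← norm_smul,
      ← tsum_const_smul'']
    refine tsum_of_norm_bounded ((hf k n).subtype _).hasSum fun i => ?_
    simpa [norm_smul] using SchwartzMap.le_seminorm ℝ k n (f i) x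
  let S : SchwartzMap E F :=
    { toFun := fun x => ∑' i, f i x
      smooth' := contDiff_tsum (N := ⊤) (fun i => (f i).smooth ⊤) (fun n _ => hf 0 n)
        fun n i x _ => hbd n i x
      decay' := fun k n => ⟨∑' i, SchwartzMap.seminorm ℝ k n (f i), fun x => by
        simpa [hder] using htail k n ∅ x⟩ }
  refine ⟨S, ((schwartz_withSeminorms ℝ E F).tendsto_nhds _ S).2 fun ⟨k, n⟩ ε hε => ?_⟩
  have hle (s : Finset ι) : SchwartzMap.seminorm ℝ k n (S - ∑ i ∈ s, f i) ≤
      ∑' i, SchwartzMap.seminorm ℝ k n (f i) - ∑ i ∈ s, SchwartzMap.seminorm ℝ k n (f i) := by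
    refine SchwartzMap.seminorm_le_bound ℝ k n _
      (sub_nonneg.2 ((hf k n).sum_le_tsum s fun i _ => apply_nonneg _ _)) fun x => ?_
    refine le_trans (le_of_eq ?_) (htail k n s x)
    have h1 : ⇑(S - ∑ i ∈ s, f i) = (fun x => ∑' i, f i x) - fun x => ∑ i ∈ s, f i x := by
      ext y
      simp [S]
      rfl
    have hS : ContDiff ℝ n fun x => ∑' i, f i x := S.smooth n
    rw [h1, iteratedFDeriv_sub_apply hS.contDiffAt
      (ContDiff.sum fun i _ => (f i).smooth n).contDiffAt, hder,
      iteratedFDeriv_fun_sum_apply fun i _ => ((f i).smooth n).contDiffAt]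
  have hlim := (tendsto_const_nhds (x := ∑' i, SchwartzMap.seminorm ℝ k n (f i))).sub
    (hf k n).hasSum
  rw [sub_self] at hlim
  filter_upwards [hlim.eventually (gt_mem_nhds hε)] with s hs
  rw [← neg_sub, map_neg_eq_map]
  exact (hle s).trans_lt hs

/-! ### Summability over lattices -/

lemma summable_inv_one_add_int_sq : Summable fun m : ℤ => (1 + (m : ℝ) ^ 2)⁻¹ := by
  refine .of_norm_bounded_eventually (Real.summable_one_div_int_pow (p := 2).2 (by simp)) ?_
  filter_upwards [(Set.finite_singleton (0 : ℤ)).compl_mem_cofinite] with m hm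
  have hm : (m : ℝ) ≠ 0 := by exact_mod_cast hm
  rw [Real.norm_of_nonneg (by positivity), one_div]
  gcongr
  linarith

/-- A tensor power of a nonnegative summable family is summable. -/
lemma Summable.finPi_prod {κ : Type*} {f : κ → ℝ} (hf : Summable f) (h0 : ∀ i, 0 ≤ f i) (d : ℕ) :
    Summable fun v : Fin d → κ => ∏ i, f (v i) := by
  induction d with
  | zero => exact (hasSum_fintype _).summable
  | succ d ih =>
    rw [← (Fin.consEquiv fun _ => κ).summable_iff]
    have := hf.mul_of_nonneg ih h0 fun v => Finset.prod_nonneg fun i _ => h0 _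
    refine this.congr fun p => ?_
    simp [Fin.prod_univ_succ, Fin.consEquiv]

/-! ### Temperate growth of the magnetic Gabor functions -/

lemma IsRegularMagneticField.hasTemperateGrowth {d : ℕ} {B : Fin d → Fin d → (Fin d → ℝ) → ℝ}
    (hB : IsRegularMagneticField d B) (j k : Fin d) : (B j k).HasTemperateGrowth := by
  refine ⟨hB.smooth j k, fun n => ?_⟩
  obtain ⟨C, hC⟩ := hB.derivBounded j k n
  exact ⟨0, C, fun x => by simpa using hC x⟩

lemma IsRegularMagneticField.hasTemperateGrowth_magA {d : ℕ}
    {B : Fin d → Fin d → (Fin d → ℝ) → ℝ} (hB : IsRegularMagneticField d B) (k : Fin d) :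
    (fun x => magA d B 0 x k).HasTemperateGrowth := by
  refine .sum fun j _ => ?_
  refine Function.HasTemperateGrowth.intervalIntegral
    (f := fun p : ℝ × E1 d => p.1 * (p.2 j - (0 : E1 d) j) * B j k (0 + p.1 • (p.2 - 0))) ?_ 0 1
  have h1 : (fun p : ℝ × E1 d => p.1).HasTemperateGrowth :=
    (ContinuousLinearMap.fst ℝ ℝ (E1 d)).hasTemperateGrowth
  have h2 : (fun p : ℝ × E1 d => p.2).HasTemperateGrowth :=
    (ContinuousLinearMap.snd ℝ ℝ (E1 d)).hasTemperateGrowth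
  have h3 : (fun p : ℝ × E1 d => p.2 j).HasTemperateGrowth :=
    (ContinuousLinearMap.proj (R := ℝ) (φ := fun _ : Fin d => ℝ) j).hasTemperateGrowth.comp h2
  exact (h1.fun_mul (h3.fun_sub (.const _))).fun_mul ((hB.hasTemperateGrowth j k).comp
    ((Function.HasTemperateGrowth.const 0).fun_add (h1.fun_smul (h2.fun_sub (.const 0)))))

lemma IsRegularMagneticField.hasTemperateGrowth_magPhi {d : ℕ}
    {B : Fin d → Fin d → (Fin d → ℝ) → ℝ} (hB : IsRegularMagneticField d B) :
    (fun p : E2 d => magPhi d B p.1 p.2).HasTemperateGrowth := by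
  refine .sum fun k _ => ?_
  refine Function.HasTemperateGrowth.intervalIntegral
    (f := fun q : ℝ × E2 d =>
      magA d B 0 (q.2.2 + q.1 • (q.2.1 - q.2.2)) k * (q.2.1 k - q.2.2 k)) ?_ 0 1
  have h1 : (fun q : ℝ × E2 d => q.1).HasTemperateGrowth :=
    (ContinuousLinearMap.fst ℝ ℝ (E2 d)).hasTemperateGrowth
  have hx : (fun q : ℝ × E2 d => q.2.1).HasTemperateGrowth :=
    (ContinuousLinearMap.fst ℝ (E1 d) (E1 d)).hasTemperateGrowth.comp
      (ContinuousLinearMap.snd ℝ ℝ (E2 d)).hasTemperateGrowth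
  have hy : (fun q : ℝ × E2 d => q.2.2).HasTemperateGrowth :=
    (ContinuousLinearMap.snd ℝ (E1 d) (E1 d)).hasTemperateGrowth.comp
      (ContinuousLinearMap.snd ℝ ℝ (E2 d)).hasTemperateGrowth
  have hp := (ContinuousLinearMap.proj (R := ℝ) (φ := fun _ : Fin d => ℝ) k).hasTemperateGrowth
  exact ((hB.hasTemperateGrowth_magA k).comp
    (hy.fun_add (h1.fun_smul (hx.fun_sub hy)))).fun_mul ((hp.comp hx).fun_sub (hp.comp hy))

/-- The magnetic Gabor function with real phase-space parameters `a`, as a function of `x`. -/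
def gaborReal (d : ℕ) (B : Fin d → Fin d → E1 d → ℝ) (g : E1 d → ℝ) (a : E2 d) (x : E1 d) : ℂ :=
  (((2 * Real.pi) ^ (-(d : ℝ) / 2) : ℝ) : ℂ) *
    Complex.exp (Complex.I * (magPhi d B x a.1 : ℂ)) * ((g (x - a.1) : ℝ) : ℂ) *
    Complex.exp (Complex.I * ((∑ i, a.2 i * (x i - a.1 i) : ℝ) : ℂ))

/-- The point of `ℝ^{2d}` underlying an index. -/
def idxToReal (d : ℕ) (a : Idx d) : E2 d := (fun i => (a.1 i : ℝ), fun i => (a.2 i : ℝ))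

lemma gabor_eq_gaborReal (d : ℕ) (B : Fin d → Fin d → E1 d → ℝ) (g : E1 d → ℝ) (a : Idx d) :
    gabor d B g a = gaborReal d B g (idxToReal d a) := rfl

lemma hasTemperateGrowth_gaborReal {d : ℕ} {B : Fin d → Fin d → (Fin d → ℝ) → ℝ}
    (hB : IsRegularMagneticField d B) {g : (Fin d → ℝ) → ℝ} (hg : IsWindow d g)
    {D : Type*} [NormedAddCommGroup D] [NormedSpace ℝ D] (u : D →L[ℝ] E1 d) (v : D →L[ℝ] E2 d) :
    (fun w => gaborReal d B g (v w) (u w)).HasTemperateGrowth := by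
  have hp (i : Fin d) :=
    (ContinuousLinearMap.proj (R := ℝ) (φ := fun _ : Fin d => ℝ) i).hasTemperateGrowth
  have h1 : (fun w => (v w).1).HasTemperateGrowth :=
    (ContinuousLinearMap.fst ℝ (E1 d) (E1 d)).hasTemperateGrowth.comp v.hasTemperateGrowth
  have h2 : (fun w => (v w).2).HasTemperateGrowth :=
    (ContinuousLinearMap.snd ℝ (E1 d) (E1 d)).hasTemperateGrowth.comp v.hasTemperateGrowth
  have hpair : (fun w => (u w, (v w).1)).HasTemperateGrowth :=
    (u.prod ((ContinuousLinearMap.fst ℝ (E1 d) (E1 d)).comp v)).hasTemperateGrowth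
  have hphi : (fun w => magPhi d B (u w) (v w).1).HasTemperateGrowth := by
    simpa only [Function.comp_def] using hB.hasTemperateGrowth_magPhi.comp hpair
  have hwin : (fun w => g (u w - (v w).1)).HasTemperateGrowth :=
    (hg.compactSupport.hasTemperateGrowth hg.smooth).comp (u.hasTemperateGrowth.fun_sub h1)
  have hmod : (fun w => ∑ i, (v w).2 i * (u w i - (v w).1 i)).HasTemperateGrowth :=
    .sum fun i _ => ((hp i).comp h2).fun_mul
      (((hp i).comp u.hasTemperateGrowth).fun_sub ((hp i).comp h1))
  have hexp {f : D → ℝ} (hf : f.HasTemperateGrowth) :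
      (fun w => Complex.exp (Complex.I * (f w : ℂ))).HasTemperateGrowth :=
    Function.HasTemperateGrowth.cexp_I_mul_ofReal.comp hf
  have hwin' : (fun w => ((g (u w - (v w).1) : ℝ) : ℂ)).HasTemperateGrowth :=
    Function.Complex.hasTemperateGrowth_ofReal.comp hwin
  unfold gaborReal
  exact (((Function.HasTemperateGrowth.const _).fun_mul (hexp hphi)).fun_mul hwin').fun_mul
    (hexp hmod)

lemma hasTemperateGrowth_gaborReal_mul_conj {d : ℕ} {B : Fin d → Fin d → (Fin d → ℝ) → ℝ}
    (hB : IsRegularMagneticField d B) {g : (Fin d → ℝ) → ℝ} (hg : IsWindow d g) :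
    (fun w : E2 d × E4 d => gaborReal d B g w.2.1 w.1.1 *
      (starRingEnd ℂ) (gaborReal d B g w.2.2 w.1.2)).HasTemperateGrowth := by
  let π₁ := ContinuousLinearMap.fst ℝ (E2 d) (E4 d)
  let π₂ := ContinuousLinearMap.snd ℝ (E2 d) (E4 d)
  exact (hasTemperateGrowth_gaborReal hB hg ((ContinuousLinearMap.fst ℝ _ _).comp π₁)
    ((ContinuousLinearMap.fst ℝ _ _).comp π₂)).fun_mul
    (Complex.conjCLE.hasTemperateGrowth.comp
      (hasTemperateGrowth_gaborReal hB hg ((ContinuousLinearMap.snd ℝ _ _).comp π₁)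
        ((ContinuousLinearMap.snd ℝ _ _).comp π₂)))

lemma norm_sub_le_one_of_gaborReal_ne_zero {d : ℕ} {B : Fin d → Fin d → (Fin d → ℝ) → ℝ}
    {g : (Fin d → ℝ) → ℝ} (hg : IsWindow d g) {a : E2 d} {x : E1 d}
    (h : gaborReal d B g a x ≠ 0) : ‖x - a.1‖ ≤ 1 := by
  have hgx : g (x - a.1) ≠ 0 := fun h0 => h (by simp [gaborReal, h0])
  exact (pi_norm_le_iff_of_nonneg zero_le_one).2 fun i => (hg.support_subset _ hgx i).le

lemma one_le_jbIdxPair (d : ℕ) (a b : Idx d) : 1 ≤ jbIdxPair d a b := by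
  rw [jbIdxPair, Real.one_le_sqrt, add_assoc, add_assoc, add_assoc]
  exact le_add_of_nonneg_right (by positivity)

lemma one_add_sq_le_jbIdxPair_sq (d : ℕ) (a b : Idx d) (i : Fin d) :
    1 + (a.1 i : ℝ) ^ 2 ≤ jbIdxPair d a b ^ 2 ∧ 1 + (a.2 i : ℝ) ^ 2 ≤ jbIdxPair d a b ^ 2 ∧
      1 + (b.1 i : ℝ) ^ 2 ≤ jbIdxPair d a b ^ 2 ∧ 1 + (b.2 i : ℝ) ^ 2 ≤ jbIdxPair d a b ^ 2 := by
  have hs (v : Fin d → ℤ) : (v i : ℝ) ^ 2 ≤ ∑ j, (v j : ℝ) ^ 2 :=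
    Finset.single_le_sum (f := fun j => (v j : ℝ) ^ 2) (fun _ _ => sq_nonneg _)
      (Finset.mem_univ i)
  have h0 (v : Fin d → ℤ) : 0 ≤ ∑ j, (v j : ℝ) ^ 2 := by positivity
  rw [jbIdxPair, Real.sq_sqrt (by positivity)]
  have := hs a.1; have := hs a.2; have := hs b.1; have := hs b.2
  have := h0 a.1; have := h0 a.2; have := h0 b.1; have := h0 b.2
  refine ⟨?_, ?_, ?_, ?_⟩ <;> linarith

lemma norm_idxToReal_le_jbIdxPair (d : ℕ) (a b : Idx d) :
    ‖(idxToReal d a, idxToReal d b)‖ ≤ jbIdxPair d a b := by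
  have hj : 0 ≤ jbIdxPair d a b := Real.sqrt_nonneg _
  have key {t : ℝ} (h : 1 + t ^ 2 ≤ jbIdxPair d a b ^ 2) : ‖t‖ ≤ jbIdxPair d a b :=
    abs_le_of_sq_le_sq (by linarith) hj
  have h := one_add_sq_le_jbIdxPair_sq d a b
  refine norm_prod_le_iff.2 ⟨norm_prod_le_iff.2 ⟨?_, ?_⟩, norm_prod_le_iff.2 ⟨?_, ?_⟩⟩ <;>
    refine (pi_norm_le_iff_of_nonneg hj).2 fun i => key ?_
  exacts [(h i).1, (h i).2.1, (h i).2.2.1, (h i).2.2.2]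

lemma summable_inv_jbIdxPair_pow (d : ℕ) :
    Summable fun q : Idx2 d => (jbIdxPair d q.1 q.2 ^ (8 * d))⁻¹ := by
  have h0 (m : ℤ) : 0 ≤ (1 + (m : ℝ) ^ 2)⁻¹ := by positivity
  have h1 := summable_inv_one_add_int_sq.finPi_prod h0 d
  have hn (v : Fin d → ℤ) : 0 ≤ ∏ i, (1 + (v i : ℝ) ^ 2)⁻¹ :=
    Finset.prod_nonneg fun i _ => h0 _
  have h2 := h1.mul_of_nonneg h1 hn hn
  have h3 := h2.mul_of_nonneg h2 (fun q => mul_nonneg (hn _) (hn _))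
    fun q => mul_nonneg (hn _) (hn _)
  refine .of_nonneg_of_le (fun q => inv_nonneg.2 (pow_nonneg (Real.sqrt_nonneg _) _))
    (fun q => ?_) h3
  have hp {v : Fin d → ℤ} (hv : ∀ i, 1 + (v i : ℝ) ^ 2 ≤ jbIdxPair d q.1 q.2 ^ 2) :
      ∏ i, (1 + (v i : ℝ) ^ 2) ≤ jbIdxPair d q.1 q.2 ^ (2 * d) := by
    rw [pow_mul]
    exact (Finset.prod_le_prod (fun i _ => by positivity) fun i _ => hv i).trans (by simp)
  have h := one_add_sq_le_jbIdxPair_sq d q.1 q.2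
  simp only [Finset.prod_inv_distrib, ← mul_inv]
  have hprod (v : Fin d → ℤ) : 0 < ∏ i, (1 + (v i : ℝ) ^ 2) :=
    Finset.prod_pos fun i _ => by positivity
  have hj : 0 ≤ jbIdxPair d q.1 q.2 := Real.sqrt_nonneg _
  refine inv_anti₀ (mul_pos (mul_pos (hprod _) (hprod _)) (mul_pos (hprod _) (hprod _))) ?_
  rw [show 8 * d = (2 * d + 2 * d) + (2 * d + 2 * d) by ring, pow_add, pow_add]
  have := fun v => (hprod v).le
  exact mul_le_mul
    (mul_le_mul (hp fun i => (h i).1) (hp fun i => (h i).2.1) (this _) (by positivity))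
    (mul_le_mul (hp fun i => (h i).2.2.1) (hp fun i => (h i).2.2.2) (this _) (by positivity))
    (mul_nonneg (this _) (this _)) (by positivity)

/-- The Schwartz seminorms of the Gabor tensors grow at most polynomially in the index. -/
lemma exists_gaborTensor_seminorm_bound {d : ℕ} {B : Fin d → Fin d → (Fin d → ℝ) → ℝ}
    (hB : IsRegularMagneticField d B) {g : (Fin d → ℝ) → ℝ} (hg : IsWindow d g) (k n : ℕ) :
    ∃ (K : ℕ) (C : ℝ), ∀ (a b : Idx d) (p : E2 d),
      ‖p‖ ^ k * ‖iteratedFDeriv ℝ n (gaborTensor d B g a b) p‖ ≤ C * jbIdxPair d a b ^ K := by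
  obtain ⟨m, C, hC, h⟩ :=
    (hasTemperateGrowth_gaborReal_mul_conj hB hg).norm_iteratedFDeriv_prodMk_le n
  refine ⟨k + m, C * 3 ^ (k + m), fun a b p => ?_⟩
  have hj := one_le_jbIdxPair d a b
  have hidx := norm_idxToReal_le_jbIdxPair d a b
  set J := jbIdxPair d a b
  by_cases hz : iteratedFDeriv ℝ n (gaborTensor d B g a b) p = 0
  · rw [hz, norm_zero, mul_zero]
    positivity
  let c : E2 d := ((idxToReal d a).1, (idxToReal d b).1)
  have hsupp : tsupport (gaborTensor d B g a b) ⊆ Metric.closedBall c 1 := by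
    refine closure_minimal (fun q hq => ?_) Metric.isClosed_closedBall
    have hq' : gaborTensor d B g a b q ≠ 0 := hq
    rw [gaborTensor, gabor_eq_gaborReal, gabor_eq_gaborReal, mul_ne_zero_iff, map_ne_zero] at hq'
    rw [mem_closedBall_iff_norm]
    exact norm_prod_le_iff.2 ⟨norm_sub_le_one_of_gaborReal_ne_zero (a := idxToReal d a) hg hq'.1,
      norm_sub_le_one_of_gaborReal_ne_zero (a := idxToReal d b) hg hq'.2⟩
  have hpc : ‖p - c‖ ≤ 1 :=
    mem_closedBall_iff_norm.1 (hsupp (support_iteratedFDeriv_subset n hz))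
  have hc : ‖c‖ ≤ J := by
    have := norm_prod_le_iff.1 hidx
    exact norm_prod_le_iff.2 ⟨(norm_prod_le_iff.1 this.1).1, (norm_prod_le_iff.1 this.2).1⟩
  have hp : ‖p‖ ≤ 1 + J := by
    have := norm_le_norm_add_norm_sub' p c
    linarith
  have hpq : ‖(p, (idxToReal d a, idxToReal d b))‖ ≤ 1 + J :=
    norm_prod_le_iff.2 ⟨hp, by linarith⟩
  calc ‖p‖ ^ k * ‖iteratedFDeriv ℝ n (gaborTensor d B g a b) p‖
      ≤ (3 * J) ^ k * (C * (3 * J) ^ m) := by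
        gcongr
        · linarith
        · refine (h p (idxToReal d a, idxToReal d b)).trans ?_
          gcongr
          linarith
    _ = C * 3 ^ (k + m) * J ^ (k + m) := by ring

/-- The Gabor tensor as a Schwartz function. -/
def gaborTensorSchwartz {d : ℕ} {B : Fin d → Fin d → (Fin d → ℝ) → ℝ}
    (hB : IsRegularMagneticField d B) {g : (Fin d → ℝ) → ℝ} (hg : IsWindow d g) (q : Idx2 d) :
    SchwartzMap (E2 d) ℂ where
  toFun := gaborTensor d B g q.1 q.2
  smooth' := by
    have h : ContDiff ℝ (⊤ : ℕ∞) fun p : E2 d => (p, (idxToReal d q.1, idxToReal d q.2)) :=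
      contDiff_prodMk_left _
    have heq : gaborTensor d B g q.1 q.2 = fun p => gaborReal d B g (idxToReal d q.1) p.1 *
        (starRingEnd ℂ) (gaborReal d B g (idxToReal d q.2) p.2) := rfl
    rw [heq]
    simpa only [Function.comp_def] using (hasTemperateGrowth_gaborReal_mul_conj hB hg).1.comp h
  decay' k n := by
    obtain ⟨K, C, h⟩ := exists_gaborTensor_seminorm_bound hB hg k n
    exact ⟨_, h q.1 q.2⟩

lemma summable_seminorm_smul_gaborTensorSchwartz {d : ℕ} {B : Fin d → Fin d → (Fin d → ℝ) → ℝ}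
    (hB : IsRegularMagneticField d B) {g : (Fin d → ℝ) → ℝ} (hg : IsWindow d g) {N : Idx2 d → ℂ}
    (hN : ∀ n : ℕ, ∃ C : ℝ, ∀ q : Idx2 d, jbIdxPair d q.1 q.2 ^ n * ‖N q‖ ≤ C) (k n : ℕ) :
    Summable fun q => SchwartzMap.seminorm ℝ k n (N q • gaborTensorSchwartz hB hg q) := by
  obtain ⟨K, C, h⟩ := exists_gaborTensor_seminorm_bound hB hg k n
  obtain ⟨C', hC'⟩ := hN (K + 8 * d)
  refine .of_nonneg_of_le (fun q => apply_nonneg _ _) (fun q => ?_)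
    ((summable_inv_jbIdxPair_pow d).mul_left (max C 0 * C'))
  have hJ : 0 < jbIdxPair d q.1 q.2 := one_pos.trans_le (one_le_jbIdxPair d q.1 q.2)
  have hbound : SchwartzMap.seminorm ℂ k n (gaborTensorSchwartz hB hg q) ≤
      max C 0 * jbIdxPair d q.1 q.2 ^ K := by
    refine SchwartzMap.seminorm_le_bound ℂ k n _ (by positivity) fun p => ?_
    refine (h q.1 q.2 p).trans ?_
    gcongr
    exact le_max_left _ _
  calc SchwartzMap.seminorm ℂ k n (N q • gaborTensorSchwartz hB hg q)
      = ‖N q‖ * SchwartzMap.seminorm ℂ k n (gaborTensorSchwartz hB hg q) := map_smul_eq_mul _ _ _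
    _ ≤ ‖N q‖ * (max C 0 * jbIdxPair d q.1 q.2 ^ K) := by gcongr
    _ = max C 0 * (jbIdxPair d q.1 q.2 ^ (K + 8 * d) * ‖N q‖) *
          (jbIdxPair d q.1 q.2 ^ (8 * d))⁻¹ := by
        rw [pow_add]
        field_simp
    _ ≤ max C 0 * C' * (jbIdxPair d q.1 q.2 ^ (8 * d))⁻¹ := by
        gcongr
        exact hC' q

/-- super-polynomially decaying coefficients give a series which is
summable in the Schwartz space, each `G_{α̃,β̃}` being a Schwartz function and each
Schwartz seminorm being summable along the family. -/
theorem statement9 (d : ℕ) (hd : 0 < d) (B : Fin d → Fin d → (Fin d → ℝ) → ℝ)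
    (hB : IsRegularMagneticField d B) (g : (Fin d → ℝ) → ℝ) (hg : IsWindow d g)
    (N : Idx2 d → ℂ)
    (hN : ∀ n : ℕ, ∃ C : ℝ, ∀ q : Idx2 d, jbIdxPair d q.1 q.2 ^ n * ‖N q‖ ≤ C) :
    ∃ GT : Idx2 d → SchwartzMap (E2 d) ℂ,
      (∀ q : Idx2 d, ⇑(GT q) = gaborTensor d B g q.1 q.2) ∧
      (∀ k n : ℕ, Summable fun q : Idx2 d => SchwartzMap.seminorm ℝ k n (N q • GT q)) ∧
      Summable fun q : Idx2 d => N q • GT q := by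
  have hsum := summable_seminorm_smul_gaborTensorSchwartz hB hg hN
  exact ⟨gaborTensorSchwartz hB hg, fun _ => rfl, hsum,
    SchwartzMap.summable_of_summable_seminorm hsum⟩
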